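/- (Basic forms are normal forms for CP) If CP ⊢ P = Q for basic forms P and Q, then P ≡ Q, i.e., P and Q are syntactically equal. -/

import Mathlib

/-- Propositional statements over atoms `A`: constants `T`, `F`, an atom `a`
for each `a ∈ A`, and the ternary conditional composition
`cond x y z = x ◁ y ▷ z` (with `y` the central condition). -/
inductive PS (A : Type) : Type where
  | tt : PS A
  | ff : PS A
  | atom : A → PS A
  | cond : PS A → PS A → PS A → PS A

/-- A valuation algebra (VA) over `A`. -/
structure VA (A : Type) where
  Val : Type
  Tv : Val
  Fv : Val
  yd : A → Val → Bool
  dv : A → Val → Val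
  yd_T : ∀ a, yd a Tv = true
  yd_F : ∀ a, yd a Fv = false
  dv_T : ∀ a, dv a Tv = Tv
  dv_F : ∀ a, dv a Fv = Fv

variable {A : Type}

mutual
  /-- Evaluation `P/H` of a propositional statement over a valuation `H`. -/
  def PS.eval (V : VA A) : PS A → V.Val → Bool
    | .tt, _ => true
    | .ff, _ => false
    | .atom a, H => V.yd a H
    | .cond p q r, H =>
        if PS.eval V q H then PS.eval V p (PS.deriv V q H)
        else PS.eval V r (PS.deriv V q H)
  /-- The generalized derivative `∂_P(H)`. -/
  def PS.deriv (V : VA A) : PS A → V.Val → V.Val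
    | .tt, H => H
    | .ff, H => H
    | .atom a, H => V.dv a H
    | .cond p q r, H =>
        if PS.eval V q H then PS.deriv V p (PS.deriv V q H)
        else PS.deriv V r (PS.deriv V q H)
end

/-- `K`-equivalence: equal evaluation results in all members of the class `K`. -/
def KEquiv (K : VA A → Prop) (P Q : PS A) : Prop :=
  ∀ V : VA A, K V → ∀ H : V.Val, PS.eval V P H = PS.eval V Q H

/-- A congruence with respect to conditional composition. -/
def IsCondCongruence (R : PS A → PS A → Prop) : Prop :=
  Equivalence R ∧
    ∀ ⦃x x' y y' z z' : PS A⦄, R x x' → R y y' → R z z' →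
      R (PS.cond x y z) (PS.cond x' y' z')

/-- `K`-congruence: the largest congruence contained in `K`-equivalence. -/
def KCong (K : VA A → Prop) (P Q : PS A) : Prop :=
  ∃ R : PS A → PS A → Prop,
    IsCondCongruence R ∧ (∀ x y, R x y → KEquiv K x y) ∧ R P Q

/-- Derivability (of closed equations) in equational logic from the axioms `CP`
together with an additional set `Ax` of equational axioms. -/
inductive Deriv (Ax : PS A → PS A → Prop) : PS A → PS A → Prop where
  | ax {p q} : Ax p q → Deriv Ax p q
  | cp1 (x y) : Deriv Ax (.cond x .tt y) x
  | cp2 (x y) : Deriv Ax (.cond x .ff y) y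
  | cp3 (x) : Deriv Ax (.cond .tt x .ff) x
  | cp4 (x y z u v) :
      Deriv Ax (.cond x (.cond y z u) v)
               (.cond (.cond x y v) z (.cond x u v))
  | refl (x) : Deriv Ax x x
  | symm {p q} : Deriv Ax p q → Deriv Ax q p
  | trans {p q r} : Deriv Ax p q → Deriv Ax q r → Deriv Ax p r
  | congr {x x' y y' z z'} : Deriv Ax x x' → Deriv Ax y y' → Deriv Ax z z' →
      Deriv Ax (.cond x y z) (.cond x' y' z')

/-- No additional axioms: plain `CP`. -/
def NoAx : PS A → PS A → Prop := fun _ _ => False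

/-- The class `fr` of free valuation algebras: all VAs. -/
def frK : VA A → Prop := fun _ => True

/-- The class `rp` of repetition-proof VAs. -/
def rpK (V : VA A) : Prop :=
  ∀ (a : A) (x : V.Val), V.yd a x = V.yd a (V.dv a x)

/-- The class `cr` of contractive VAs. -/
def crK (V : VA A) : Prop :=
  rpK V ∧ ∀ (a : A) (x : V.Val), V.dv a (V.dv a x) = V.dv a x

/-- The class `wm` of weakly memorizing VAs. -/
def wmK (V : VA A) : Prop :=
  crK V ∧ ∀ (a b : A) (x : V.Val),
    V.yd b (V.dv a x) = V.yd a x →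
      V.dv a (V.dv b (V.dv a x)) = V.dv b (V.dv a x) ∧
      V.yd a (V.dv b (V.dv a x)) = V.yd a x

/-- The class `mem` of memorizing VAs. -/
def memK (V : VA A) : Prop :=
  crK V ∧ ∀ (a b : A) (x : V.Val),
    V.dv a (V.dv b (V.dv a x)) = V.dv b (V.dv a x) ∧
    V.yd a (V.dv b (V.dv a x)) = V.yd a x

/-- The class `st` of static VAs. -/
def stK (V : VA A) : Prop :=
  ∀ (a b : A) (x : V.Val), V.yd a (V.dv b x) = V.yd a x

/-- Basic forms: `T`, `F`, or `P1 ◁ a ▷ P2` with `a ∈ A` and `P1`, `P2`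
basic forms. -/
inductive BasicForm {A : Type} : PS A → Prop where
  | tt : BasicForm .tt
  | ff : BasicForm .ff
  | cond {p q : PS A} (a : A) :
      BasicForm p → BasicForm q → BasicForm (.cond p (.atom a) q)

/-- Replace the leaves `T` and `F` of a conditional tree by `p` and `q`, leaving the
conditions at its nodes unchanged. -/
def PS.substLeaves (p q : PS A) : PS A → PS A
  | .tt => p
  | .ff => q
  | .atom a => .atom a
  | .cond x y z => .cond (substLeaves p q x) y (substLeaves p q z)

/-- The basic form of a propositional statement. -/
def PS.basicForm : PS A → PS A
  | .tt => .tt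
  | .ff => .ff
  | .atom a => .cond .tt (.atom a) .ff
  | .cond x y z => substLeaves (basicForm x) (basicForm z) (basicForm y)

theorem PS.substLeaves_tt_ff (x : PS A) : substLeaves .tt .ff x = x := by
  induction x <;> simp_all [substLeaves]

theorem PS.substLeaves_substLeaves (x v y u z : PS A) :
    substLeaves x v (substLeaves y u z) =
      substLeaves (substLeaves x v y) (substLeaves x v u) z := by
  induction z <;> simp_all [substLeaves]

theorem BasicForm.basicForm_eq {p : PS A} (hp : BasicForm p) : p.basicForm = p := by
  induction hp <;> simp_all [PS.basicForm, PS.substLeaves]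

theorem Deriv.basicForm_eq {p q : PS A} (h : Deriv NoAx p q) :
    p.basicForm = q.basicForm := by
  induction h with
  | ax h => exact h.elim
  | cp1 | cp2 => rfl
  | cp3 x => exact PS.substLeaves_tt_ff _
  | cp4 => exact PS.substLeaves_substLeaves ..
  | refl => rfl
  | symm _ ih => exact ih.symm
  | trans _ _ ih₁ ih₂ => exact ih₁.trans ih₂
  | congr _ _ _ ih₁ ih₂ ih₃ => simp only [PS.basicForm, ih₁, ih₂, ih₃]

/-- **Basic forms are normal forms for CP**: if `CP ⊢ P = Q` for basic forms
`P` and `Q`, then `P` and `Q` are syntactically equal. -/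
theorem basic_forms_unique {A : Type} [Countable A] [Nontrivial A]
    (P Q : PS A) (hP : BasicForm P) (hQ : BasicForm Q)
    (h : Deriv NoAx P Q) : P = Q := by
  rw [← hP.basicForm_eq, h.basicForm_eq, hQ.basicForm_eq]
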